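/- Let T be a positive integer, a₁, a₂ ∈ ℝ^{2T} with a₁ ≠ a₂, let B ∈ ℝ^{2T×2T} be symmetric positive definite, let δ < 1, and let λ ∈ [0,1]. For y ∈ ℝ^{2T} with (a₂ − a₁)ᵀ y > 0, define m₁(y) = (1−δ) a₁ᵀ y, m₂(y) = (1−δ) a₂ᵀ y, σ(y) = (1−δ)√(yᵀ B y), ζ(y) = λ m₁(y) + (1−λ) m₂(y), and the classification errors ε₁(y) = Q((ζ(y) − m₁(y))/σ(y)) and ε₂(y) = Q((m₂(y) − ζ(y))/σ(y)), where Q(x) = (1/√(2π)) ∫_x^∞ e^{−u²/2} du. Then y* = B^{−1}(a₂ − a₁) simultaneously minimizes both ε₁ and ε₂ over all y with (a₂ − a₁)ᵀ y > 0, and every minimizer of ε₁ (equivalently of ε₂) is a positive scalar multiple of y*. -/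

import Mathlib

open Matrix MeasureTheory

/-- The Gaussian tail function `Q(x) = (1/√(2π)) ∫_x^∞ e^{−u²/2} du`. -/
noncomputable def gaussQ (x : ℝ) : ℝ :=
  (Real.sqrt (2 * Real.pi))⁻¹ * ∫ u in Set.Ioi x, Real.exp (-u ^ 2 / 2)

theorem gaussQ_strictAnti : StrictAnti gaussQ := by
  intro x y hxy
  have hint : Integrable (fun u : ℝ => Real.exp (-u ^ 2 / 2)) := by
    have h := integrable_exp_neg_mul_sq (b := 1 / 2) (by norm_num)
    refine h.congr (Filter.Eventually.of_forall fun u => ?_)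
    show Real.exp _ = Real.exp _
    congr 1
    ring
  unfold gaussQ
  apply mul_lt_mul_of_pos_left _ (by positivity)
  have h1 := intervalIntegral.integral_interval_add_Ioi (a := x) (b := y) (μ := volume)
    (f := fun u : ℝ => Real.exp (-u ^ 2 / 2)) hint.integrableOn hint.integrableOn
  have h2 : 0 < ∫ u in x..y, Real.exp (-u ^ 2 / 2) :=
    intervalIntegral.intervalIntegral_pos_of_pos hint.intervalIntegrable
      (fun u => Real.exp_pos _) hxy
  linarith

/-- (Proposition 1 of the paper.) The label vector
`y* = B⁻¹(a₂ − a₁)` simultaneously minimizes both classification errors over all `y` with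
`(a₂ − a₁)ᵀ y > 0`, and every such minimizer is a positive scalar multiple of `y*`. -/
theorem stmt_6 (T : ℕ) (hT : 0 < T) (a₁ a₂ : Fin (2 * T) → ℝ) (ha : a₁ ≠ a₂)
    (B : Matrix (Fin (2 * T)) (Fin (2 * T)) ℝ) (hB : B.PosDef)
    (δ : ℝ) (hδ : δ < 1) (lam : ℝ) (hlam : lam ∈ Set.Icc (0 : ℝ) 1) :
    let m₁ : (Fin (2 * T) → ℝ) → ℝ := fun y => (1 - δ) * (a₁ ⬝ᵥ y)
    let m₂ : (Fin (2 * T) → ℝ) → ℝ := fun y => (1 - δ) * (a₂ ⬝ᵥ y)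
    let σ : (Fin (2 * T) → ℝ) → ℝ := fun y => (1 - δ) * Real.sqrt (y ⬝ᵥ B.mulVec y)
    let ζ : (Fin (2 * T) → ℝ) → ℝ := fun y => lam * m₁ y + (1 - lam) * m₂ y
    let ε₁ : (Fin (2 * T) → ℝ) → ℝ := fun y => gaussQ ((ζ y - m₁ y) / σ y)
    let ε₂ : (Fin (2 * T) → ℝ) → ℝ := fun y => gaussQ ((m₂ y - ζ y) / σ y)
    let ystar : Fin (2 * T) → ℝ := B⁻¹.mulVec (a₂ - a₁)
    0 < (a₂ - a₁) ⬝ᵥ ystar ∧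
    (∀ y : Fin (2 * T) → ℝ, 0 < (a₂ - a₁) ⬝ᵥ y → ε₁ ystar ≤ ε₁ y ∧ ε₂ ystar ≤ ε₂ y) ∧
    (∀ y : Fin (2 * T) → ℝ, 0 < (a₂ - a₁) ⬝ᵥ y →
      (∀ z : Fin (2 * T) → ℝ, 0 < (a₂ - a₁) ⬝ᵥ z → ε₁ y ≤ ε₁ z) →
      (∀ z : Fin (2 * T) → ℝ, 0 < (a₂ - a₁) ⬝ᵥ z → ε₂ y ≤ ε₂ z) →
      ∃ c : ℝ, 0 < c ∧ y = c • ystar) := by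
  intro m₁ m₂ σ ζ ε₁ ε₂ ystar
  have hBy : B *ᵥ ystar = a₂ - a₁ := by
    show B *ᵥ (B⁻¹ *ᵥ (a₂ - a₁)) = _
    rw [Matrix.mulVec_mulVec, Matrix.mul_nonsing_inv _ hB.det_pos.ne'.isUnit, Matrix.one_mulVec]
  have hpos : ∀ y : Fin (2 * T) → ℝ, y ≠ 0 → 0 < y ⬝ᵥ B *ᵥ y := fun y hy => by
    simpa using hB.dotProduct_mulVec_pos hy
  have hd : a₂ - a₁ ≠ 0 := sub_ne_zero.mpr ha.symm
  have hys : ystar ≠ 0 := by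
    intro h
    rw [h, Matrix.mulVec_zero] at hBy
    exact hd hBy.symm
  have hsym : ∀ y, ystar ⬝ᵥ B *ᵥ y = (a₂ - a₁) ⬝ᵥ y := fun y => by
    have hBt : Bᵀ = B := by simpa using hB.isHermitian.eq
    rw [Matrix.dotProduct_mulVec, ← Matrix.mulVec_transpose, hBt, hBy]
  have hs : 0 < (a₂ - a₁) ⬝ᵥ ystar := by
    rw [← hsym]; exact hpos _ hys
  set s := (a₂ - a₁) ⬝ᵥ ystar with hsdef
  have hδ' : 0 < 1 - δ := by linarith
  let r : (Fin (2 * T) → ℝ) → ℝ := fun y => ((a₂ - a₁) ⬝ᵥ y) / Real.sqrt (y ⬝ᵥ B *ᵥ y)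
  have e1 : ∀ y, ε₁ y = gaussQ ((1 - lam) * r y) := fun y => by
    show gaussQ _ = gaussQ _
    congr 1
    simp only [r, ζ, m₁, m₂, σ, sub_dotProduct]
    rw [← mul_div_assoc, ← mul_div_mul_left _ (Real.sqrt _) hδ'.ne']
    congr 1
    ring
  have e2 : ∀ y, ε₂ y = gaussQ (lam * r y) := fun y => by
    show gaussQ _ = gaussQ _
    congr 1
    simp only [r, ζ, m₁, m₂, σ, sub_dotProduct]
    rw [← mul_div_assoc, ← mul_div_mul_left _ (Real.sqrt _) hδ'.ne']
    congr 1
    ring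
  have hrs : r ystar = Real.sqrt s := by
    show s / Real.sqrt (ystar ⬝ᵥ B *ᵥ ystar) = _
    rw [hsym, ← hsdef, Real.div_sqrt]
  have hne : ∀ y, 0 < (a₂ - a₁) ⬝ᵥ y → y ≠ 0 := by
    rintro y hy rfl
    simp at hy
  have hw : ∀ y, (y - (((a₂ - a₁) ⬝ᵥ y) / s) • ystar) ⬝ᵥ
      B *ᵥ (y - (((a₂ - a₁) ⬝ᵥ y) / s) • ystar)
      = y ⬝ᵥ B *ᵥ y - ((a₂ - a₁) ⬝ᵥ y) ^ 2 / s := fun y => by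
    rw [Matrix.mulVec_sub, Matrix.mulVec_smul, sub_dotProduct, dotProduct_sub, dotProduct_sub,
      smul_dotProduct, smul_dotProduct, dotProduct_smul, dotProduct_smul, hBy, hsym,
      dotProduct_comm y (a₂ - a₁), dotProduct_comm ystar (a₂ - a₁), ← hsdef]
    simp only [smul_eq_mul]
    field_simp
    ring
  have hrsq : ∀ y, 0 < (a₂ - a₁) ⬝ᵥ y → r y ^ 2 * (y ⬝ᵥ B *ᵥ y) = ((a₂ - a₁) ⬝ᵥ y) ^ 2 :=
    fun y hy => by
      have h := hpos y (hne y hy)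
      simp only [r, div_pow, Real.sq_sqrt h.le]
      field_simp
  have hle : ∀ y, 0 < (a₂ - a₁) ⬝ᵥ y → r y ≤ r ystar := fun y hy => by
    rw [hrs]
    apply Real.le_sqrt_of_sq_le
    have h := hpos y (hne y hy)
    have h0 : 0 ≤ y ⬝ᵥ B *ᵥ y - ((a₂ - a₁) ⬝ᵥ y) ^ 2 / s := by
      rw [← hw]
      simpa using hB.posSemidef.dotProduct_mulVec_nonneg (y - (((a₂ - a₁) ⬝ᵥ y) / s) • ystar)
    have h1 : ((a₂ - a₁) ⬝ᵥ y) ^ 2 ≤ (y ⬝ᵥ B *ᵥ y) * s := (div_le_iff₀ hs).mp (by linarith)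
    rw [← hrsq y hy, mul_comm] at h1
    exact le_of_mul_le_mul_left h1 h
  refine ⟨hs, fun y hy => ⟨?_, ?_⟩, fun y hy h1 h2 => ?_⟩
  · rw [e1, e1]
    exact gaussQ_strictAnti.antitone (mul_le_mul_of_nonneg_left (hle y hy) (by linarith [hlam.2]))
  · rw [e2, e2]
    exact gaussQ_strictAnti.antitone (mul_le_mul_of_nonneg_left (hle y hy) hlam.1)
  · have k1 := h1 ystar hs
    have k2 := h2 ystar hs
    rw [e1, e1, gaussQ_strictAnti.le_iff_ge] at k1
    rw [e2, e2, gaussQ_strictAnti.le_iff_ge] at k2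
    have hr : r y = r ystar := le_antisymm (hle y hy) (by linarith)
    refine ⟨((a₂ - a₁) ⬝ᵥ y) / s, div_pos hy hs, ?_⟩
    by_contra hcon
    have h3 := hpos _ (sub_ne_zero.mpr hcon)
    have h4 := hrsq y hy
    rw [hr, hrs, Real.sq_sqrt hs.le] at h4
    rw [hw, ← h4, mul_div_cancel_left₀ _ hs.ne', sub_self] at h3
    exact lt_irrefl _ h3
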